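/- arXiv:math/0211287 — 16 statements merged into one kernel-verified Lean document; each statement's English description precedes it below -/
import Mathlib

section
/- For all real numbers a, b, c, d, e, f, g, h, the four Poincaré–Lyapunov constants D1 = 2(a + c), D2 = −4ab − 4bc + 3d + f + 3h, D3 = 2(−85a³ + 15ab² − 67a²c + 15b²c + 61ac² + 43c³ − 24bd − 34ae − 22ce − 12bf − 50ag − 38cg − 48bh), and D4 = 44600a³b + 2736ab³ + 84696a²bc + 2736b³c + 47688abc² + 7592bc³ − 37120a²d − 1782b²d − 32552acd − 2704c²d + 2364abe + 1284bce − 2673de − 6120a²f − 234b²f − 3384acf + 792c²f − 891ef + 6876abg + 5076bcg − 3807dg − 1269fg + 4720a²h + 1098b²h + 31448ach + 19456c²h − 2673eh − 3807gh all vanish if and only if the four relations a + c = 0, 3d + f + 3h = 0, 3ce − bf + 3cg − 6bh = 0, and 2c²f − 3bcg + 3b²h = 0 hold. -/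
/-- The first four Poincaré–Lyapunov constants of the quintic system vanish
iff the four simplified relations hold. -/
theorem stmt_0 (a b c d e f g h : ℝ) :
    (2*(a + c) = 0 ∧
     -4*a*b - 4*b*c + 3*d + f + 3*h = 0 ∧
     2*(-85*a^3 + 15*a*b^2 - 67*a^2*c + 15*b^2*c + 61*a*c^2 + 43*c^3 - 24*b*d - 34*a*e -
        22*c*e - 12*b*f - 50*a*g - 38*c*g - 48*b*h) = 0 ∧
     44600*a^3*b + 2736*a*b^3 + 84696*a^2*b*c + 2736*b^3*c + 47688*a*b*c^2 + 7592*b*c^3 -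
       37120*a^2*d - 1782*b^2*d - 32552*a*c*d - 2704*c^2*d + 2364*a*b*e + 1284*b*c*e -
       2673*d*e - 6120*a^2*f - 234*b^2*f - 3384*a*c*f + 792*c^2*f - 891*e*f +
       6876*a*b*g + 5076*b*c*g - 3807*d*g - 1269*f*g + 4720*a^2*h + 1098*b^2*h +
       31448*a*c*h + 19456*c^2*h - 2673*e*h - 3807*g*h = 0)
    ↔ (a + c = 0 ∧ 3*d + f + 3*h = 0 ∧ 3*c*e - b*f + 3*c*g - 6*b*h = 0 ∧
       2*c^2*f - 3*b*c*g + 3*b^2*h = 0) := by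
  constructor
  · rintro ⟨h1, h2, h3, h4⟩
    obtain rfl : a = -c := by linarith
    obtain rfl : f = -3*d - 3*h := by linarith
    have key : 3*c*e - b*(-3*d - 3*h) + 3*c*g - 6*b*h = 0 := by linear_combination h3 / 8
    exact ⟨by ring, by ring, key, by linear_combination h4 / 240 + 3 / 2 * b * key⟩
  · rintro ⟨h1, h2, h3, h4⟩
    obtain rfl : a = -c := by linarith
    obtain rfl : f = -3*d - 3*h := by linarith
    exact ⟨by ring, by ring, by linear_combination 8 * h3,
      by linear_combination 240 * h4 - 360 * b * h3⟩
end

section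
/- Let b, c, d, e, f, g, h be real numbers and set a = 0. Then the four relations a + c = 0, 3d + f + 3h = 0, 3ce − bf + 3cg − 6bh = 0, and 2c²f − 3bcg + 3b²h = 0 hold simultaneously if and only if either (b = 0 and c = 0 and f = −3(d + h)) or (c = 0 and d = 0 and f = 0 and h = 0). -/
/-- With `a = 0`, the four relations are equivalent to case (i) or case (ii). -/
theorem stmt_2 (a b c d e f g h : ℝ) (ha : a = 0) :
    (a + c = 0 ∧
     3*d + f + 3*h = 0 ∧
     3*c*e - b*f + 3*c*g - 6*b*h = 0 ∧
     2*c^2*f - 3*b*c*g + 3*b^2*h = 0)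
    ↔ ((b = 0 ∧ c = 0 ∧ f = -3*(d + h)) ∨ (c = 0 ∧ d = 0 ∧ f = 0 ∧ h = 0)) := by
  subst ha
  constructor
  · rintro ⟨hc, h₁, h₂, h₃⟩
    obtain rfl : c = 0 := by linarith
    by_cases hb : b = 0
    · exact Or.inl ⟨hb, rfl, by linarith⟩
    · have hh : h = 0 := by
        have : b ^ 2 * h = 0 := by linarith
        exact (mul_eq_zero.mp this).resolve_left (pow_ne_zero 2 hb)
      subst hh
      have hf : f = 0 := by
        have : b * f = 0 := by linarith
        exact (mul_eq_zero.mp this).resolve_left hb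
      exact Or.inr ⟨rfl, by linarith, hf, rfl⟩
  · rintro (⟨rfl, rfl, rfl⟩ | ⟨rfl, rfl, rfl, rfl⟩) <;>
      refine ⟨?_, ?_, ?_, ?_⟩ <;> ring
end

section
/- Let a, b, d, e be real numbers with a ≠ 0 and let F : ℝ² → ℝ² be the vector field of system (7), F(x,y) = ( y + x·K(x,y)/(2a³), −x + y·K(x,y)/(2a³) ), where K(x,y) = (a x² + b x y − a y²)(2a³ + 2a²d x² − 2abd x y + 2a²e x y + (2a²d − b²d + abe) y²). Then for the linear map S given by the matrix (4a² + b²)^(−1/2)·[[−b, 2a], [2a, b]] (and likewise for −S), one has S(F(x,y)) = −F(S(x,y)) for all (x,y) ∈ ℝ²; i.e., system (7) is reversible, its trajectories being symmetric with respect to each of the two perpendicular lines a x² + b x y − a y² = 0. -/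
/-- The cubic-quintic factor of system (7). -/
noncomputable def K7 (a b d e : ℝ) (x y : ℝ) : ℝ :=
  (a * x^2 + b * x * y - a * y^2) *
    (2*a^3 + 2*a^2*d*x^2 - 2*a*b*d*x*y + 2*a^2*e*x*y + (2*a^2*d - b^2*d + a*b*e) * y^2)

/-- The vector field of system (7). -/
noncomputable def F7 (a b d e : ℝ) (p : ℝ × ℝ) : ℝ × ℝ :=
  (p.2 + p.1 * K7 a b d e p.1 p.2 / (2*a^3),
   -p.1 + p.2 * K7 a b d e p.1 p.2 / (2*a^3))

/-- The reflection `S = (4a² + b²)^(−1/2)·[[−b, 2a], [2a, b]]`. -/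
noncomputable def S7 (a b : ℝ) (p : ℝ × ℝ) : ℝ × ℝ :=
  ((Real.sqrt (4*a^2 + b^2))⁻¹ * (-b * p.1 + 2*a * p.2),
   (Real.sqrt (4*a^2 + b^2))⁻¹ * (2*a * p.1 + b * p.2))

theorem K7_neg (a b d e x y : ℝ) : K7 a b d e (-x) (-y) = K7 a b d e x y := by
  unfold K7
  ring

theorem F7_neg (a b d e : ℝ) (p : ℝ × ℝ) : F7 a b d e (-p) = -F7 a b d e p := by
  ext <;> simp only [F7, Prod.fst_neg, Prod.snd_neg, K7_neg] <;> ring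

theorem K7_reflection (a b d e s x y : ℝ) (hs : s ^ 2 * (4 * a ^ 2 + b ^ 2) = 1) :
    K7 a b d e (s * (-b * x + 2 * a * y)) (s * (2 * a * x + b * y)) = -K7 a b d e x y := by
  unfold K7
  set u := s * (-b * x + 2 * a * y) with hu
  set v := s * (2 * a * x + b * y) with hv
  have h₁ : a * u ^ 2 + b * u * v - a * v ^ 2 = -(a * x ^ 2 + b * x * y - a * y ^ 2) := by
    rw [hu, hv]
    linear_combination (-(a * x ^ 2 + b * x * y - a * y ^ 2)) * hs
  have h₂ : 2*a^3 + 2*a^2*d*u^2 - 2*a*b*d*u*v + 2*a^2*e*u*v + (2*a^2*d - b^2*d + a*b*e) * v^2 =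
      2*a^3 + 2*a^2*d*x^2 - 2*a*b*d*x*y + 2*a^2*e*x*y + (2*a^2*d - b^2*d + a*b*e) * y^2 := by
    rw [hu, hv]
    linear_combination (2*a^2*d*x^2 - 2*a*b*d*x*y + 2*a^2*e*x*y +
      (2*a^2*d - b^2*d + a*b*e) * y^2) * hs
  rw [h₁, h₂]
  ring

/-- System (7) is reversible with respect to the reflection `S` (and likewise `−S`). -/
theorem stmt_4 (a b d e : ℝ) (ha : a ≠ 0) :
    ∀ p : ℝ × ℝ,
      S7 a b (F7 a b d e p) = - F7 a b d e (S7 a b p) ∧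
      -(S7 a b (F7 a b d e p)) = - F7 a b d e (-(S7 a b p)) := by
  intro p
  have hs : (Real.sqrt (4*a^2 + b^2))⁻¹ ^ 2 * (4 * a ^ 2 + b ^ 2) = 1 := by
    have hpos : 0 < 4 * a ^ 2 + b ^ 2 := by positivity
    rw [inv_pow, Real.sq_sqrt hpos.le, inv_mul_cancel₀ hpos.ne']
  have h : S7 a b (F7 a b d e p) = -F7 a b d e (S7 a b p) := by
    ext <;> simp only [S7, F7, Prod.fst_neg, Prod.snd_neg, K7_reflection _ _ _ _ _ _ _ hs] <;> ring
  exact ⟨h, by rw [F7_neg, h]⟩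
end

section
/- Let R, Q : ℝ² → ℝ be continuously differentiable and define the planar vector fields X(x,y) = (y + x·R(x,y), −x + y·R(x,y)) and Y(x,y) = (x·Q(x,y), y·Q(x,y)). If X and Y commute, i.e., their Lie bracket vanishes identically (DX(x,y)·Y(x,y) − DY(x,y)·X(x,y) = 0 for all (x,y)), then the curve Q = 0 is invariant for X with cofactor x·∂R/∂x + y·∂R/∂y: for all (x,y) ∈ ℝ², ∂Q/∂x·(y + xR) + ∂Q/∂y·(−x + yR) = (x·∂R/∂x + y·∂R/∂y)·Q(x,y). -/
/-- If the vector field `X = (y + xR, −x + yR)` commutes with `Y = (xQ, yQ)`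
(vanishing Lie bracket), then the curve `Q = 0` is invariant for `X` with
cofactor `x·R_x + y·R_y`. -/
theorem stmt_6 (R Q : ℝ × ℝ → ℝ) (hR : ContDiff ℝ 1 R) (hQ : ContDiff ℝ 1 Q)
    (hcomm : ∀ p : ℝ × ℝ,
      fderiv ℝ (fun q : ℝ × ℝ => (q.2 + q.1 * R q, -q.1 + q.2 * R q)) p
          ((fun q : ℝ × ℝ => (q.1 * Q q, q.2 * Q q)) p) -
        fderiv ℝ (fun q : ℝ × ℝ => (q.1 * Q q, q.2 * Q q)) p
          ((fun q : ℝ × ℝ => (q.2 + q.1 * R q, -q.1 + q.2 * R q)) p) = 0) :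
    ∀ x y : ℝ,
      fderiv ℝ Q (x, y) (1, 0) * (y + x * R (x, y)) +
        fderiv ℝ Q (x, y) (0, 1) * (-x + y * R (x, y)) =
      (x * fderiv ℝ R (x, y) (1, 0) + y * fderiv ℝ R (x, y) (0, 1)) * Q (x, y) := by
  intro x y
  have hRd := (hR.differentiable one_ne_zero (x, y)).hasFDerivAt
  have hQd := (hQ.differentiable one_ne_zero (x, y)).hasFDerivAt
  have h₁ : HasFDerivAt (fun q : ℝ × ℝ => q.1) (ContinuousLinearMap.fst ℝ ℝ ℝ) (x, y) :=
    hasFDerivAt_fst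
  have h₂ : HasFDerivAt (fun q : ℝ × ℝ => q.2) (ContinuousLinearMap.snd ℝ ℝ ℝ) (x, y) :=
    hasFDerivAt_snd
  have hX := (h₂.fun_add (h₁.fun_mul hRd)).prodMk (h₁.fun_neg.fun_add (h₂.fun_mul hRd))
  have hY := (h₁.fun_mul hQd).prodMk (h₂.fun_mul hQd)
  have coord (L : ℝ × ℝ →L[ℝ] ℝ) (a b : ℝ) : L (a, b) = a * L (1, 0) + b * L (0, 1) := by
    have hab : ((a, b) : ℝ × ℝ) = a • (1, 0) + b • (0, 1) := by simp
    rw [hab, map_add, map_smul, map_smul, smul_eq_mul, smul_eq_mul]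
  have h := hcomm (x, y)
  rw [hX.fderiv, hY.fderiv] at h
  have e₁ := congrArg Prod.fst h
  have e₂ := congrArg Prod.snd h
  simp only [ContinuousLinearMap.prod_apply, add_apply,
    neg_apply, smul_apply, ContinuousLinearMap.coe_fst',
    ContinuousLinearMap.coe_snd', smul_eq_mul, Prod.fst_sub, Prod.snd_sub, Prod.fst_zero,
    Prod.snd_zero] at e₁ e₂
  rw [coord (fderiv ℝ R (x, y)), coord (fderiv ℝ Q (x, y))] at e₁ e₂
  by_cases hx : x = 0
  · by_cases hy : y = 0
    · simp [hx, hy]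
    · apply mul_left_cancel₀ hy
      linear_combination -e₂
  · apply mul_left_cancel₀ hx
    linear_combination -e₁
end

section
/- Let d, e, g, h be real numbers and set f = −3(d + h). Define p₄(x,y) = d x⁴ + e x³y + f x²y² + g x y³ + h y⁴ and q₄(x,y) = e x⁴ − 4d x³y + 4h x y³ − g y⁴, and the vector fields X(x,y) = (y + x·p₄(x,y), −x + y·p₄(x,y)) and Y(x,y) = (x(1 + q₄(x,y)), y(1 + q₄(x,y))). Then X and Y commute: DX(x,y)·Y(x,y) − DY(x,y)·X(x,y) = 0 for all (x,y) ∈ ℝ². -/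
/-- The quartic form `p₄` of system (4). -/
noncomputable def p4 (d e f g h : ℝ) (x y : ℝ) : ℝ :=
  d * x^4 + e * x^3 * y + f * x^2 * y^2 + g * x * y^3 + h * y^4

/-- The quartic form `q₄` of the commuting system. -/
noncomputable def q4 (d e g h : ℝ) (x y : ℝ) : ℝ :=
  e * x^4 - 4*d * x^3 * y + 4*h * x * y^3 - g * y^4

open ContinuousLinearMap in
/-- The derivative of `p4` in terms of its partial derivatives. -/
lemma hasFDerivAt_p4 (d e f g h : ℝ) (p : ℝ × ℝ) :
    HasFDerivAt (fun q : ℝ × ℝ => p4 d e f g h q.1 q.2)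
      ((4*d * p.1^3 + 3*e * p.1^2 * p.2 + 2*f * p.1 * p.2^2 + g * p.2^3) • fst ℝ ℝ ℝ +
        (e * p.1^3 + 2*f * p.1^2 * p.2 + 3*g * p.1 * p.2^2 + 4*h * p.2^3) • snd ℝ ℝ ℝ) p := by
  have hx : HasFDerivAt (fun q : ℝ × ℝ => q.1) (fst ℝ ℝ ℝ) p := hasFDerivAt_fst
  have hy : HasFDerivAt (fun q : ℝ × ℝ => q.2) (snd ℝ ℝ ℝ) p := hasFDerivAt_snd
  refine HasFDerivAt.congr_fderiv (((((hx.pow 4).const_mul d).add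
    (((hx.pow 3).const_mul e).mul hy)).add (((hx.pow 2).const_mul f).mul (hy.pow 2))).add
    ((hx.const_mul g).mul (hy.pow 3)) |>.add ((hy.pow 4).const_mul h)) ?_
  ext <;> simp <;> ring

open ContinuousLinearMap in
/-- The derivative of `q4` in terms of its partial derivatives. -/
lemma hasFDerivAt_q4 (d e g h : ℝ) (p : ℝ × ℝ) :
    HasFDerivAt (fun q : ℝ × ℝ => q4 d e g h q.1 q.2)
      ((4*e * p.1^3 - 12*d * p.1^2 * p.2 + 4*h * p.2^3) • fst ℝ ℝ ℝ +
        (-4*d * p.1^3 + 12*h * p.1 * p.2^2 - 4*g * p.2^3) • snd ℝ ℝ ℝ) p := by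
  have hx : HasFDerivAt (fun q : ℝ × ℝ => q.1) (fst ℝ ℝ ℝ) p := hasFDerivAt_fst
  have hy : HasFDerivAt (fun q : ℝ × ℝ => q.2) (snd ℝ ℝ ℝ) p := hasFDerivAt_snd
  refine HasFDerivAt.congr_fderiv (((((hx.pow 4).const_mul e).sub
    (((hx.pow 3).const_mul (4*d)).mul hy)).add ((hx.const_mul (4*h)).mul (hy.pow 3))).sub
    ((hy.pow 4).const_mul g)) ?_
  ext <;> simp <;> ring

/-- System (4) (with `f = −3(d + h)`) commutes with the system
`ẋ = x(1 + q₄), ẏ = y(1 + q₄)`. -/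
theorem stmt_7 (d e f g h : ℝ) (hf : f = -3*(d + h)) :
    ∀ p : ℝ × ℝ,
      fderiv ℝ (fun q : ℝ × ℝ =>
          (q.2 + q.1 * p4 d e f g h q.1 q.2, -q.1 + q.2 * p4 d e f g h q.1 q.2)) p
          ((fun q : ℝ × ℝ =>
            (q.1 * (1 + q4 d e g h q.1 q.2), q.2 * (1 + q4 d e g h q.1 q.2))) p) -
        fderiv ℝ (fun q : ℝ × ℝ =>
          (q.1 * (1 + q4 d e g h q.1 q.2), q.2 * (1 + q4 d e g h q.1 q.2))) p
          ((fun q : ℝ × ℝ =>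
            (q.2 + q.1 * p4 d e f g h q.1 q.2, -q.1 + q.2 * p4 d e f g h q.1 q.2)) p)
      = 0 := by
  intro p
  have hx : HasFDerivAt (fun q : ℝ × ℝ => q.1) (ContinuousLinearMap.fst ℝ ℝ ℝ) p :=
    hasFDerivAt_fst
  have hy : HasFDerivAt (fun q : ℝ × ℝ => q.2) (ContinuousLinearMap.snd ℝ ℝ ℝ) p :=
    hasFDerivAt_snd
  have hp := hasFDerivAt_p4 d e f g h p
  have hq := (hasFDerivAt_q4 d e g h p).const_add 1
  have hX := (hy.add (hx.mul hp)).prodMk (hx.neg.add (hy.mul hp))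
  have hY := (hx.mul hq).prodMk (hy.mul hq)
  have hX' := hX.fderiv
  have hY' := hY.fderiv
  simp only [Pi.add_def, Pi.mul_def, Pi.neg_def] at hX' hY'
  rw [hX', hY']
  subst hf
  ext <;> simp [p4, q4] <;> ring
end

section
/- Let d, e, g, h be real numbers, set f = −3(d + h), and define p₄(x,y) = d x⁴ + e x³y + f x²y² + g x y³ + h y⁴ and q₄(x,y) = e x⁴ − 4d x³y + 4h x y³ − g y⁴. Then H(x,y) = (x² + y²)² / (1 + q₄(x,y)) is a first integral of system (4): at every point (x,y) with 1 + q₄(x,y) ≠ 0, ∂H/∂x·(y + x·p₄(x,y)) + ∂H/∂y·(−x + y·p₄(x,y)) = 0. -/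
/-- The rational first integral `H = (x² + y²)² / (1 + q₄)` of system (4). -/
noncomputable def H4 (d e g h : ℝ) (p : ℝ × ℝ) : ℝ :=
  (p.1^2 + p.2^2)^2 / (1 + q4 d e g h p.1 p.2)

/-- `H = (x² + y²)²/(1 + q₄)` is a first integral of system (4)
(with `f = −3(d + h)`) wherever `1 + q₄ ≠ 0`. -/
theorem stmt_8 (d e f g h : ℝ) (hf : f = -3*(d + h)) (x y : ℝ)
    (hden : 1 + q4 d e g h x y ≠ 0) :
    fderiv ℝ (H4 d e g h) (x, y) (1, 0) * (y + x * p4 d e f g h x y) +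
      fderiv ℝ (H4 d e g h) (x, y) (0, 1) * (-x + y * p4 d e f g h x y) = 0 := by
  have hx : HasFDerivAt (fun p : ℝ × ℝ => p.1) (ContinuousLinearMap.fst ℝ ℝ ℝ) (x, y) :=
    hasFDerivAt_fst
  have hy : HasFDerivAt (fun p : ℝ × ℝ => p.2) (ContinuousLinearMap.snd ℝ ℝ ℝ) (x, y) :=
    hasFDerivAt_snd
  have hN := ((hx.pow 2).add (hy.pow 2)).pow 2
  have hD := (((((hx.pow 4).const_mul e).sub (((hx.pow 3).const_mul (4 * d)).mul hy)).add
    ((hx.const_mul (4 * h)).mul (hy.pow 3))).sub ((hy.pow 4).const_mul g)).const_add 1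
  have hH : HasFDerivAt (H4 d e g h) _ (x, y) :=
    hN.mul ((hasDerivAt_inv hden).comp_hasFDerivAt (x, y) hD)
  rw [hH.fderiv]
  simp only [p4, hf, add_apply, sub_apply,
    smul_apply, ContinuousLinearMap.coe_fst', ContinuousLinearMap.coe_snd',
    Pi.add_apply, smul_eq_mul, nsmul_eq_mul]
  field_simp
  rw [q4]
  ring
end

section
/- Let d, e, g, h be real numbers, set f = −3(d + h), and define p₄(x,y) = d x⁴ + e x³y + f x²y² + g x y³ + h y⁴ and q₄(x,y) = e x⁴ − 4d x³y + 4h x y³ − g y⁴. Then μ(x,y) = 1 / ((x² + y²)(1 + q₄(x,y))) is an integrating factor of system (4): at every point (x,y) with (x² + y²)(1 + q₄(x,y)) ≠ 0, ∂/∂x( μ(x,y)·(y + x·p₄(x,y)) ) + ∂/∂y( μ(x,y)·(−x + y·p₄(x,y)) ) = 0. -/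
/-- The Darboux integrating factor `μ = 1/((x² + y²)(1 + q₄))`. -/
noncomputable def mu4 (d e g h : ℝ) (p : ℝ × ℝ) : ℝ :=
  1 / ((p.1^2 + p.2^2) * (1 + q4 d e g h p.1 p.2))

theorem fderiv_apply_one_zero_of_hasDerivAt {F : ℝ × ℝ → ℝ} {x y F' : ℝ}
    (hF : DifferentiableAt ℝ F (x, y)) (h : HasDerivAt (fun t => F (t, y)) F' x) :
    fderiv ℝ F (x, y) (1, 0) = F' :=
  (hF.hasFDerivAt.comp_hasDerivAt x
    ((hasDerivAt_id x).prodMk (hasDerivAt_const x y))).unique h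

theorem fderiv_apply_zero_one_of_hasDerivAt {F : ℝ × ℝ → ℝ} {x y F' : ℝ}
    (hF : DifferentiableAt ℝ F (x, y)) (h : HasDerivAt (fun t => F (x, t)) F' y) :
    fderiv ℝ F (x, y) (0, 1) = F' :=
  (hF.hasFDerivAt.comp_hasDerivAt y
    ((hasDerivAt_const y x).prodMk (hasDerivAt_id y))).unique h

theorem hasDerivAt_p4_left (d e f g h x y : ℝ) :
    HasDerivAt (fun t => p4 d e f g h t y)
      (4 * d * x^3 + 3 * e * x^2 * y + 2 * f * x * y^2 + g * y^3) x := by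
  unfold p4
  have hp (n : ℕ) := hasDerivAt_pow n x
  refine HasDerivAt.congr_deriv ((((((hp 4).const_mul d).add
    (((hp 3).const_mul e).mul_const y)).add (((hp 2).const_mul f).mul_const (y^2))).add
    (((hasDerivAt_id x).const_mul g).mul_const (y^3))).add_const (h * y^4)) ?_
  norm_num
  ring

theorem hasDerivAt_p4_right (d e f g h x y : ℝ) :
    HasDerivAt (fun t => p4 d e f g h x t)
      (e * x^3 + 2 * f * x^2 * y + 3 * g * x * y^2 + 4 * h * y^3) y := by
  convert hasDerivAt_p4_left h g f e d y x using 1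
  · funext t
    unfold p4
    ring
  · ring

theorem hasDerivAt_q4_left (d e g h x y : ℝ) :
    HasDerivAt (fun t => q4 d e g h t y)
      (4 * e * x^3 - 12 * d * x^2 * y + 4 * h * y^3) x := by
  convert hasDerivAt_p4_left e (-4 * d) 0 (4 * h) (-g) x y using 1
  · funext t
    unfold p4 q4
    ring
  · ring

theorem hasDerivAt_q4_right (d e g h x y : ℝ) :
    HasDerivAt (fun t => q4 d e g h x t)
      (-4 * d * x^3 + 12 * h * x * y^2 - 4 * g * y^3) y := by
  convert hasDerivAt_p4_right e (-4 * d) 0 (4 * h) (-g) x y using 1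
  · funext t
    unfold p4 q4
    ring
  · ring

theorem differentiable_p4 (d e f g h : ℝ) :
    Differentiable ℝ (fun p : ℝ × ℝ => p4 d e f g h p.1 p.2) := by
  unfold p4
  fun_prop

theorem differentiable_q4 (d e g h : ℝ) :
    Differentiable ℝ (fun p : ℝ × ℝ => q4 d e g h p.1 p.2) := by
  unfold q4
  fun_prop

theorem differentiableAt_mu4 {d e g h x y : ℝ}
    (hden : (x^2 + y^2) * (1 + q4 d e g h x y) ≠ 0) :
    DifferentiableAt ℝ (mu4 d e g h) (x, y) := by
  have hr : DifferentiableAt ℝ (fun p : ℝ × ℝ => p.1^2 + p.2^2) (x, y) := by fun_prop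
  have hV := hr.fun_mul ((differentiable_q4 d e g h (x, y)).const_add 1)
  have hmu := hV.fun_inv hden
  simp only [← one_div] at hmu
  exact hmu

theorem hasDerivAt_mu4_left {d e g h x y : ℝ}
    (hden : (x^2 + y^2) * (1 + q4 d e g h x y) ≠ 0) :
    HasDerivAt (fun t => mu4 d e g h (t, y))
      (-(2 * x * (1 + q4 d e g h x y) +
        (x^2 + y^2) * (4 * e * x^3 - 12 * d * x^2 * y + 4 * h * y^3)) /
        ((x^2 + y^2) * (1 + q4 d e g h x y))^2) x := by
  unfold mu4
  simp only [one_div]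
  refine (HasDerivAt.mul (((hasDerivAt_pow 2 x).add_const (y^2)).congr_deriv ?_)
    ((hasDerivAt_q4_left d e g h x y).const_add 1)).fun_inv hden
  norm_num

theorem hasDerivAt_mu4_right {d e g h x y : ℝ}
    (hden : (x^2 + y^2) * (1 + q4 d e g h x y) ≠ 0) :
    HasDerivAt (fun t => mu4 d e g h (x, t))
      (-(2 * y * (1 + q4 d e g h x y) +
        (x^2 + y^2) * (-4 * d * x^3 + 12 * h * x * y^2 - 4 * g * y^3)) /
        ((x^2 + y^2) * (1 + q4 d e g h x y))^2) y := by
  unfold mu4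
  simp only [one_div]
  refine (HasDerivAt.mul (((hasDerivAt_pow 2 y).const_add (x^2)).congr_deriv ?_)
    ((hasDerivAt_q4_right d e g h x y).const_add 1)).fun_inv hden
  norm_num

/-- `μ = 1/((x² + y²)(1 + q₄))` is an integrating factor of system (4)
(with `f = −3(d + h)`) wherever `(x² + y²)(1 + q₄) ≠ 0`. -/
theorem stmt_9 (d e f g h : ℝ) (hf : f = -3*(d + h)) (x y : ℝ)
    (hden : (x^2 + y^2) * (1 + q4 d e g h x y) ≠ 0) :
    fderiv ℝ (fun p : ℝ × ℝ =>
        mu4 d e g h p * (p.2 + p.1 * p4 d e f g h p.1 p.2)) (x, y) (1, 0) +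
      fderiv ℝ (fun p : ℝ × ℝ =>
        mu4 d e g h p * (-p.1 + p.2 * p4 d e f g h p.1 p.2)) (x, y) (0, 1) = 0 := by
  have hp := differentiable_p4 d e f g h
  have hmu := differentiableAt_mu4 hden
  rw [fderiv_apply_one_zero_of_hasDerivAt
      (F := fun p => mu4 d e g h p * (p.2 + p.1 * p4 d e f g h p.1 p.2))
      (hmu.mul (differentiableAt_snd.add (differentiableAt_fst.mul (hp _))))
      ((hasDerivAt_mu4_left hden).mul
        (((hasDerivAt_id x).mul (hasDerivAt_p4_left d e f g h x y)).const_add y)),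
    fderiv_apply_zero_one_of_hasDerivAt
      (F := fun p => mu4 d e g h p * (-p.1 + p.2 * p4 d e f g h p.1 p.2))
      (hmu.mul (differentiableAt_fst.neg.add (differentiableAt_snd.mul (hp _))))
      ((hasDerivAt_mu4_right hden).mul
        (((hasDerivAt_id y).mul (hasDerivAt_p4_right d e f g h x y)).const_add (-x)))]
  subst hf
  simp only [mu4, id]
  field_simp
  unfold p4 q4
  ring
end

section
/- Let b, e, g be real numbers and define the vector fields X(x,y) = (y + x²y(b + e x² + g y²), −x + x y²(b + e x² + g y²)) and Y(x,y) = ((e − g)x + x(e x² + g y²)(b + e x² + g y²), (e − g)y + y(e x² + g y²)(b + e x² + g y²)). Then X and Y commute: DX(x,y)·Y(x,y) − DY(x,y)·X(x,y) = 0 for all (x,y) ∈ ℝ². -/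
/-- System (5) commutes with the field
`ẋ = (e−g)x + x(ex² + gy²)(b + ex² + gy²), ẏ = (e−g)y + y(ex² + gy²)(b + ex² + gy²)`. -/
theorem stmt_10 (b e g : ℝ) :
    ∀ p : ℝ × ℝ,
      fderiv ℝ (fun q : ℝ × ℝ =>
          (q.2 + q.1^2 * q.2 * (b + e * q.1^2 + g * q.2^2),
           -q.1 + q.1 * q.2^2 * (b + e * q.1^2 + g * q.2^2))) p
          ((fun q : ℝ × ℝ =>
            ((e - g) * q.1 + q.1 * (e * q.1^2 + g * q.2^2) * (b + e * q.1^2 + g * q.2^2),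
             (e - g) * q.2 + q.2 * (e * q.1^2 + g * q.2^2) * (b + e * q.1^2 + g * q.2^2))) p) -
        fderiv ℝ (fun q : ℝ × ℝ =>
          ((e - g) * q.1 + q.1 * (e * q.1^2 + g * q.2^2) * (b + e * q.1^2 + g * q.2^2),
           (e - g) * q.2 + q.2 * (e * q.1^2 + g * q.2^2) * (b + e * q.1^2 + g * q.2^2))) p
          ((fun q : ℝ × ℝ =>
            (q.2 + q.1^2 * q.2 * (b + e * q.1^2 + g * q.2^2),
             -q.1 + q.1 * q.2^2 * (b + e * q.1^2 + g * q.2^2))) p)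
      = 0 := by
  intro p
  have hx : HasFDerivAt (fun q : ℝ × ℝ => q.1) (ContinuousLinearMap.fst ℝ ℝ ℝ) p := hasFDerivAt_fst
  have hy : HasFDerivAt (fun q : ℝ × ℝ => q.2) (ContinuousLinearMap.snd ℝ ℝ ℝ) p := hasFDerivAt_snd
  have hex := (hx.pow 2).const_mul e
  have hgy := (hy.pow 2).const_mul g
  have hS := (hex.const_add b).fun_add hgy
  have hw := hex.fun_add hgy
  have hX := (hy.fun_add (((hx.pow 2).fun_mul hy).fun_mul hS)).prodMk
    (hx.fun_neg.fun_add ((hx.fun_mul (hy.pow 2)).fun_mul hS))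
  have hY := ((hx.const_mul (e - g)).fun_add ((hx.fun_mul hw).fun_mul hS)).prodMk
    ((hy.const_mul (e - g)).fun_add ((hy.fun_mul hw).fun_mul hS))
  rw [hX.fderiv, hY.fderiv]
  ext <;> simp <;> ring
end

section
/- Let b, e, g be real numbers. Then μ(x,y) = 1 / ( (x² + y²)·(e − g + (e x² + g y²)(b + e x² + g y²)) ) is an integrating factor of system (5): at every point (x,y) where (x² + y²)·(e − g + (e x² + g y²)(b + e x² + g y²)) ≠ 0, ∂/∂x( μ(x,y)·(y + x²y(b + e x² + g y²)) ) + ∂/∂y( μ(x,y)·(−x + x y²(b + e x² + g y²)) ) = 0. -/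
/-- The Darboux integrating factor of system (5). -/
noncomputable def mu5 (b e g : ℝ) (p : ℝ × ℝ) : ℝ :=
  1 / ((p.1^2 + p.2^2) *
    (e - g + (e * p.1^2 + g * p.2^2) * (b + e * p.1^2 + g * p.2^2)))

theorem fderiv_apply_one_zero {f : ℝ × ℝ → ℝ} {x y d : ℝ} (hf : DifferentiableAt ℝ f (x, y))
    (hd : HasDerivAt (fun t => f (t, y)) d x) : fderiv ℝ f (x, y) (1, 0) = d :=
  (hf.hasFDerivAt.comp_hasDerivAt x
    ((hasDerivAt_id x).prodMk (hasDerivAt_const x y))).unique hd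

theorem fderiv_apply_zero_one {f : ℝ × ℝ → ℝ} {x y d : ℝ} (hf : DifferentiableAt ℝ f (x, y))
    (hd : HasDerivAt (fun t => f (x, t)) d y) : fderiv ℝ f (x, y) (0, 1) = d :=
  (hf.hasFDerivAt.comp_hasDerivAt y
    ((hasDerivAt_const y x).prodMk (hasDerivAt_id y))).unique hd

theorem differentiableAt_mu5 {b e g x y : ℝ}
    (hden : (x^2 + y^2) *
      (e - g + (e * x^2 + g * y^2) * (b + e * x^2 + g * y^2)) ≠ 0) :
    DifferentiableAt ℝ (mu5 b e g) (x, y) := by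
  unfold mu5
  simp only [one_div]
  apply DifferentiableAt.fun_inv
  · fun_prop
  · exact hden

/-- `μ = 1/((x² + y²)(e − g + (ex² + gy²)(b + ex² + gy²)))` is an integrating
factor of system (5) wherever the denominator does not vanish. -/
theorem stmt_11 (b e g : ℝ) (x y : ℝ)
    (hden : (x^2 + y^2) *
      (e - g + (e * x^2 + g * y^2) * (b + e * x^2 + g * y^2)) ≠ 0) :
    fderiv ℝ (fun p : ℝ × ℝ =>
        mu5 b e g p * (p.2 + p.1^2 * p.2 * (b + e * p.1^2 + g * p.2^2))) (x, y) (1, 0) +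
      fderiv ℝ (fun p : ℝ × ℝ =>
        mu5 b e g p * (-p.1 + p.1 * p.2^2 * (b + e * p.1^2 + g * p.2^2))) (x, y) (0, 1)
      = 0 := by
  have hμ := differentiableAt_mu5 hden
  have hsq (t : ℝ) : HasDerivAt (fun t : ℝ => t ^ 2) (2 * t) t := by
    simpa using hasDerivAt_pow 2 t
  have hsx := (hsq x).const_mul e
  have hsy := (hsq y).const_mul g
  have hhx := (hsx.const_add b).add_const (g * y ^ 2)
  have hhy := hsy.const_add (b + e * x ^ 2)
  have hVx := ((hsq x).add_const (y ^ 2)).fun_mul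
    (((hsx.add_const (g * y ^ 2)).fun_mul hhx).const_add (e - g))
  have hVy := ((hsq y).const_add (x ^ 2)).fun_mul
    (((hsy.const_add (e * x ^ 2)).fun_mul hhy).const_add (e - g))
  have hP := (((hsq x).mul_const y).fun_mul hhx).const_add y
  have hQ := (((hsq y).const_mul x).fun_mul hhy).const_add (-x)
  rw [fderiv_apply_one_zero (hμ.fun_mul (by fun_prop))
      (((hasDerivAt_const x (1 : ℝ)).fun_div hVx hden).fun_mul hP),
    fderiv_apply_zero_one (hμ.fun_mul (by fun_prop))
      (((hasDerivAt_const y (1 : ℝ)).fun_div hVy hden).fun_mul hQ)]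
  obtain ⟨hr, hF⟩ := mul_ne_zero_iff.mp hden
  field_simp
  ring
end

section
/- Let e, g be real numbers and let F(x,y) = (y + x²y(1 + e x² + g y²), −x + x y²(1 + e x² + g y²)) be the vector field of system (11). Then the curve C₂(x,y) = e − g + (e x² + g y²) + (e x² + g y²)² = 0 is invariant for F with cofactor L₂(x,y) = 2xy(1 + 2(e x² + g y²)): for all (x,y) ∈ ℝ², ∂C₂/∂x·(y + x²y(1 + e x² + g y²)) + ∂C₂/∂y·(−x + x y²(1 + e x² + g y²)) = L₂(x,y)·C₂(x,y). -/
/-- The invariant algebraic curve `C₂ = e − g + (ex² + gy²) + (ex² + gy²)²`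
of system (11). -/
noncomputable def C2 (e g : ℝ) (p : ℝ × ℝ) : ℝ :=
  e - g + (e * p.1^2 + g * p.2^2) + (e * p.1^2 + g * p.2^2)^2

/-- The partial derivatives of `C₂`, as the coefficients of its Fréchet derivative. -/
theorem fderiv_C2_apply (e g : ℝ) (p v : ℝ × ℝ) :
    fderiv ℝ (C2 e g) p v =
      (1 + 2 * (e * p.1^2 + g * p.2^2)) * (2 * e * p.1 * v.1 + 2 * g * p.2 * v.2) := by
  have hu := ((hasFDerivAt_fst (𝕜 := ℝ) (p := p)).pow 2 |>.const_mul e).add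
    ((hasFDerivAt_snd (𝕜 := ℝ) (p := p)).pow 2 |>.const_mul g)
  have hC : HasFDerivAt (C2 e g) _ p := (hu.const_add (e - g)).add (hu.pow 2)
  rw [hC.fderiv]
  simp
  ring

/-- `C₂ = 0` is invariant for system (11) with cofactor `L₂ = 2xy(1 + 2(ex² + gy²))`. -/
theorem stmt_12 (e g : ℝ) :
    ∀ x y : ℝ,
      fderiv ℝ (C2 e g) (x, y) (1, 0) *
          (y + x^2 * y * (1 + e * x^2 + g * y^2)) +
        fderiv ℝ (C2 e g) (x, y) (0, 1) *
          (-x + x * y^2 * (1 + e * x^2 + g * y^2)) =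
      2 * x * y * (1 + 2 * (e * x^2 + g * y^2)) * C2 e g (x, y) := by
  intro x y
  simp only [fderiv_C2_apply, C2]
  ring
end

section
/- Let e, g be real numbers with 4(e − g) − 1 > 0, let k = √(4(e − g) − 1), and write v(x,y) = e x² + g y². Then the function H(x,y) = (x² + y²)² / ( (e − g + v + v²) · exp( (2/k)·( arctan((1 + 2v)/k) − arctan(1/k) ) ) ) is a first integral of system (11): for all (x,y) ∈ ℝ², ∂H/∂x·(y + x²y(1 + v)) + ∂H/∂y·(−x + x y²(1 + v)) = 0. (Note that e − g + v + v² > 0 for all (x,y) since the quadratic t² + t + (e − g) has negative discriminant.) -/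
/-- The quadratic form `v = ex² + gy²`. -/
noncomputable def v11 (e g : ℝ) (p : ℝ × ℝ) : ℝ := e * p.1^2 + g * p.2^2

/-- The Darboux first integral of system (11) in the case `4(e − g) − 1 > 0`,
with the arctangent antiderivative of `1/(e − g + t + t²)`. -/
noncomputable def H14 (e g : ℝ) (p : ℝ × ℝ) : ℝ :=
  (p.1^2 + p.2^2)^2 /
    ((e - g + v11 e g p + (v11 e g p)^2) *
      Real.exp ((2 / Real.sqrt (4*(e - g) - 1)) *
        (Real.arctan ((1 + 2 * v11 e g p) / Real.sqrt (4*(e - g) - 1)) -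
         Real.arctan (1 / Real.sqrt (4*(e - g) - 1)))))

/-- The derivative of `(c + t + t²) exp(∫ dt / (c + t + t²))`, with the arctangent antiderivative. -/
lemma hasDerivAt_quadratic_mul_exp_arctan {c : ℝ} (hc : 4 * c - 1 > 0) (a t : ℝ) :
    HasDerivAt
      (fun t : ℝ => (c + t + t ^ 2) * Real.exp ((2 / Real.sqrt (4 * c - 1)) *
        (Real.arctan ((1 + 2 * t) / Real.sqrt (4 * c - 1)) - a)))
      ((2 + 2 * t) * Real.exp ((2 / Real.sqrt (4 * c - 1)) *
        (Real.arctan ((1 + 2 * t) / Real.sqrt (4 * c - 1)) - a))) t := by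
  have hk : 0 < Real.sqrt (4 * c - 1) := Real.sqrt_pos.mpr hc
  have hk2 : Real.sqrt (4 * c - 1) ^ 2 = 4 * c - 1 := Real.sq_sqrt hc.le
  generalize Real.sqrt (4 * c - 1) = k at hk hk2 ⊢
  have hD : 0 < c + t + t ^ 2 := by nlinarith [sq_nonneg (1 + 2 * t)]
  have hlin : HasDerivAt (fun t : ℝ => (1 + 2 * t) / k) (2 / k) t := by
    simpa using (((hasDerivAt_id t).const_mul 2).const_add 1).div_const k
  have hF : HasDerivAt (fun t : ℝ => 2 / k * (Real.arctan ((1 + 2 * t) / k) - a))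
      (1 / (c + t + t ^ 2)) t := by
    refine ((hlin.arctan.sub_const a).const_mul (2 / k)).congr_deriv ?_
    have hden : 1 + ((1 + 2 * t) / k) ^ 2 = 4 * (c + t + t ^ 2) / k ^ 2 := by
      field_simp
      linear_combination hk2
    rw [hden]
    field_simp
    norm_num
  have hQ : HasDerivAt (fun t : ℝ => c + t + t ^ 2) (1 + 2 * t) t := by
    simpa using ((hasDerivAt_id t).const_add c).fun_add (hasDerivAt_pow 2 t)
  refine (hQ.mul hF.exp).congr_deriv ?_
  field_simp
  ring

/-- In the case `4(e − g) − 1 > 0`, `H14` is a first integral of system (11)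
on all of `ℝ²`. -/
theorem stmt_14 (e g : ℝ) (hk : 4*(e - g) - 1 > 0) :
    ∀ x y : ℝ,
      fderiv ℝ (H14 e g) (x, y) (1, 0) *
          (y + x^2 * y * (1 + v11 e g (x, y))) +
        fderiv ℝ (H14 e g) (x, y) (0, 1) *
          (-x + x * y^2 * (1 + v11 e g (x, y))) = 0 := by
  intro x y
  have hX : HasFDerivAt (fun p : ℝ × ℝ => p.1) (ContinuousLinearMap.fst ℝ ℝ ℝ) (x, y) :=
    hasFDerivAt_fst
  have hY : HasFDerivAt (fun p : ℝ × ℝ => p.2) (ContinuousLinearMap.snd ℝ ℝ ℝ) (x, y) :=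
    hasFDerivAt_snd
  have hv : HasFDerivAt (v11 e g) _ (x, y) :=
    ((hX.pow 2).const_mul e).add ((hY.pow 2).const_mul g)
  have hr := ((hX.pow 2).add (hY.pow 2)).pow 2
  have hG := hasDerivAt_quadratic_mul_exp_arctan hk
    (Real.arctan (1 / Real.sqrt (4 * (e - g) - 1))) (v11 e g (x, y))
  have hD : 0 < e - g + v11 e g (x, y) + v11 e g (x, y) ^ 2 := by
    nlinarith [sq_nonneg (1 + 2 * v11 e g (x, y))]
  have hG0 := (mul_pos hD (Real.exp_pos ((2 / Real.sqrt (4 * (e - g) - 1)) *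
    (Real.arctan ((1 + 2 * v11 e g (x, y)) / Real.sqrt (4 * (e - g) - 1)) -
      Real.arctan (1 / Real.sqrt (4 * (e - g) - 1)))))).ne'
  have hH : HasFDerivAt (H14 e g) _ (x, y) :=
    hr.mul ((hG.inv hG0).comp_hasFDerivAt (x, y) hv)
  rw [hH.fderiv]
  have hvxy : v11 e g (x, y) = e * x ^ 2 + g * y ^ 2 := rfl
  simp
  generalize v11 e g (x, y) = v at *
  field_simp
  linear_combination 4 * x * y * (x ^ 2 + y ^ 2) ^ 2 * (1 + v) ^ 2 * hvxy
end

section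
/- Let e, g be real numbers with 4(e − g) − 1 = 0, and write v(x,y) = e x² + g y². Then the function H(x,y) = (x² + y²)² / ( ((1 + 2v)²/4) · exp( 2 − 2/(1 + 2v) ) ) is a first integral of system (11): at every point (x,y) with 1 + 2v(x,y) ≠ 0, ∂H/∂x·(y + x²y(1 + v)) + ∂H/∂y·(−x + x y²(1 + v)) = 0. (Here e − g + v + v² = (1 + 2v)²/4 since e − g = 1/4.) -/
/-- The Darboux first integral of system (11) in the case `4(e − g) − 1 = 0`,
with the antiderivative `−2/(1 + 2t)` of `1/(e − g + t + t²)`. -/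
noncomputable def H15 (e g : ℝ) (p : ℝ × ℝ) : ℝ :=
  (p.1^2 + p.2^2)^2 /
    (((1 + 2 * v11 e g p)^2 / 4) *
      Real.exp (2 - 2 / (1 + 2 * v11 e g p)))

theorem hasFDerivAt_v11 (e g : ℝ) (p : ℝ × ℝ) :
    HasFDerivAt (v11 e g)
      ((2 * e * p.1) • ContinuousLinearMap.fst ℝ ℝ ℝ +
        (2 * g * p.2) • ContinuousLinearMap.snd ℝ ℝ ℝ) p := by
  have h := ((hasFDerivAt_fst (𝕜 := ℝ) (p := p)).pow 2).const_mul e |>.add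
    (((hasFDerivAt_snd (𝕜 := ℝ) (p := p)).pow 2).const_mul g)
  refine h.congr_fderiv ?_
  ext <;> simp <;> ring

/-- Derivative of the denominator of `H15`, as a function of `v`. -/
theorem hasDerivAt_H15_denominator {t : ℝ} (ht : 1 + 2 * t ≠ 0) :
    HasDerivAt (fun t : ℝ => ((1 + 2 * t)^2 / 4) * Real.exp (2 - 2 / (1 + 2 * t)))
      ((2 + 2 * t) * Real.exp (2 - 2 / (1 + 2 * t))) t := by
  have hw : HasDerivAt (fun t : ℝ => 1 + 2 * t) 2 t := by
    simpa using ((hasDerivAt_id t).const_mul 2).const_add 1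
  have h := ((hw.pow 2).div_const 4).mul
    (((hasDerivAt_const t (2 : ℝ)).div hw ht).const_sub 2).exp
  refine h.congr_deriv ?_
  simp
  field_simp
  ring

theorem hasFDerivAt_H15 (e g : ℝ) (p : ℝ × ℝ) (hp : 1 + 2 * v11 e g p ≠ 0) :
    HasFDerivAt (H15 e g)
      ((4 * (p.1^2 + p.2^2) /
          (((1 + 2 * v11 e g p)^2 / 4) * Real.exp (2 - 2 / (1 + 2 * v11 e g p)))) •
        (p.1 • ContinuousLinearMap.fst ℝ ℝ ℝ + p.2 • ContinuousLinearMap.snd ℝ ℝ ℝ) -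
      (H15 e g p * (8 * (1 + v11 e g p) / (1 + 2 * v11 e g p)^2)) •
        ((2 * e * p.1) • ContinuousLinearMap.fst ℝ ℝ ℝ +
          (2 * g * p.2) • ContinuousLinearMap.snd ℝ ℝ ℝ)) p := by
  have hN := (((hasFDerivAt_fst (𝕜 := ℝ) (p := p)).pow 2).add
    ((hasFDerivAt_snd (𝕜 := ℝ) (p := p)).pow 2)).pow 2
  have hD := (hasDerivAt_H15_denominator hp).comp_hasFDerivAt p (hasFDerivAt_v11 e g p)
  have hE := Real.exp_ne_zero (2 - 2 / (1 + 2 * v11 e g p))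
  have h := hN.mul ((hasDerivAt_inv (by simp [hp])).comp_hasFDerivAt p hD)
  refine (h.congr_fderiv ?_).congr_of_eventuallyEq (.of_forall fun q => div_eq_mul_inv _ _)
  simp only [H15, Function.comp_apply]
  generalize Real.exp (2 - 2 / (1 + 2 * v11 e g p)) = E at *
  ext <;> simp <;> field_simp <;> ring

/-- In the case `4(e − g) − 1 = 0`, `H15` is a first integral of system (11)
wherever `1 + 2v ≠ 0`. -/
theorem stmt_15 (e g : ℝ) (hk : 4*(e - g) - 1 = 0) :
    ∀ x y : ℝ, 1 + 2 * v11 e g (x, y) ≠ 0 →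
      fderiv ℝ (H15 e g) (x, y) (1, 0) *
          (y + x^2 * y * (1 + v11 e g (x, y))) +
        fderiv ℝ (H15 e g) (x, y) (0, 1) *
          (-x + x * y^2 * (1 + v11 e g (x, y))) = 0 := by
  intro x y h
  rw [(hasFDerivAt_H15 e g (x, y) h).fderiv]
  have hE := Real.exp_ne_zero (2 - 2 / (1 + 2 * v11 e g (x, y)))
  simp only [H15, sub_apply, add_apply, smul_apply,
    ContinuousLinearMap.coe_fst', ContinuousLinearMap.coe_snd',
    smul_eq_mul]
  generalize Real.exp (2 - 2 / (1 + 2 * v11 e g (x, y))) = E at *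
  have hv : v11 e g (x, y) = e * x^2 + g * y^2 := rfl
  generalize v11 e g (x, y) = v at *
  obtain rfl : e = g + 1 / 4 := by linarith
  field_simp
  subst hv
  ring
end

section
/- Let e, g be real numbers with 4(e − g) − 1 < 0 and e ≠ g, let k = √(1 − 4(e − g)), and write v(x,y) = e x² + g y². Define A(x,y) = ((1 + 2v − k)(1 + k)) / ((1 + 2v + k)(1 − k)). Then the function H(x,y) = (x² + y²)² / ( (e − g + v + v²) · exp( (1/k)·ln A(x,y) ) ) is a first integral of system (11): at every point (x,y) where A(x,y) > 0 (which also entails e − g + v + v² ≠ 0, since 4(e − g + v + v²) = (1 + 2v)² − k²), one has ∂H/∂x·(y + x²y(1 + v)) + ∂H/∂y·(−x + x y²(1 + v)) = 0. -/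
/-- The argument of the logarithm in the case `4(e − g) − 1 < 0`:
`A = ((1 + 2v − k)(1 + k))/((1 + 2v + k)(1 − k))` with `k = √(1 − 4(e − g))`. -/
noncomputable def A16 (e g : ℝ) (p : ℝ × ℝ) : ℝ :=
  ((1 + 2 * v11 e g p - Real.sqrt (1 - 4*(e - g))) * (1 + Real.sqrt (1 - 4*(e - g)))) /
    ((1 + 2 * v11 e g p + Real.sqrt (1 - 4*(e - g))) * (1 - Real.sqrt (1 - 4*(e - g))))

/-- The Darboux first integral of system (11) in the case `4(e − g) − 1 < 0`,
with the logarithmic antiderivative of `1/(e − g + t + t²)`. -/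
noncomputable def H16 (e g : ℝ) (p : ℝ × ℝ) : ℝ :=
  (p.1^2 + p.2^2)^2 /
    ((e - g + v11 e g p + (v11 e g p)^2) *
      Real.exp ((1 / Real.sqrt (1 - 4*(e - g))) * Real.log (A16 e g p)))

/-- A linear combination of squares has the expected gradient. -/
theorem hasFDerivAt_diagonal_form (a b x y : ℝ) :
    HasFDerivAt (fun p : ℝ × ℝ => a * p.1 ^ 2 + b * p.2 ^ 2)
      ((2 * a * x) • ContinuousLinearMap.fst ℝ ℝ ℝ + (2 * b * y) • ContinuousLinearMap.snd ℝ ℝ ℝ)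
      (x, y) := by
  have h1 : HasFDerivAt (fun p : ℝ × ℝ => p.1) (ContinuousLinearMap.fst ℝ ℝ ℝ) (x, y) :=
    hasFDerivAt_fst
  have h2 : HasFDerivAt (fun p : ℝ × ℝ => p.2) (ContinuousLinearMap.snd ℝ ℝ ℝ) (x, y) :=
    hasFDerivAt_snd
  refine (((h1.pow 2).const_mul a).add ((h2.pow 2).const_mul b)).congr_fderiv ?_
  ext <;> simp <;> ring

/-- The logarithmic antiderivative of `1 / (c + t + t²)`, where `k² = 1 - 4c`. -/
theorem hasDerivAt_log_antiderivative {c k t : ℝ} (hk : k ≠ 0) (hkc : k ^ 2 = 1 - 4 * c)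
    (hA : ((1 + 2 * t - k) * (1 + k)) / ((1 + 2 * t + k) * (1 - k)) ≠ 0) :
    HasDerivAt
      (fun s => 1 / k * Real.log (((1 + 2 * s - k) * (1 + k)) / ((1 + 2 * s + k) * (1 - k))))
      (1 / (c + t + t ^ 2)) t := by
  obtain ⟨hn, hd⟩ := div_ne_zero_iff.mp hA
  obtain ⟨hn₁, hn₂⟩ := mul_ne_zero_iff.mp hn
  obtain ⟨hd₁, hd₂⟩ := mul_ne_zero_iff.mp hd
  have hl : HasDerivAt (fun s : ℝ => 1 + 2 * s) 2 t := by
    simpa using ((hasDerivAt_id t).const_mul 2).const_add 1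
  have hD : c + t + t ^ 2 = (1 + 2 * t - k) * (1 + 2 * t + k) / 4 := by
    linear_combination (1 / 4) * hkc
  refine (((((hl.sub_const k).mul_const (1 + k)).div
    ((hl.add_const k).mul_const (1 - k)) hd).log hA).const_mul (1 / k)).congr_deriv ?_
  simp only [Pi.div_apply]
  rw [hD]
  field_simp
  ring

/-- The reciprocal integrating function `1 / (D exp F)` with `D = c + t + t²`, `F' = 1 / D`. -/
theorem hasDerivAt_inv_mul_exp {c t : ℝ} {F : ℝ → ℝ} (hD : c + t + t ^ 2 ≠ 0)
    (hF : HasDerivAt F (1 / (c + t + t ^ 2)) t) :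
    HasDerivAt (fun s => ((c + s + s ^ 2) * Real.exp (F s))⁻¹)
      (-(2 + 2 * t) / ((c + t + t ^ 2) ^ 2 * Real.exp (F t))) t := by
  have hq : HasDerivAt (fun s : ℝ => c + s + s ^ 2) (1 + 2 * t) t := by
    simpa using ((hasDerivAt_id' t).const_add c).fun_add ((hasDerivAt_id' t).fun_pow 2)
  refine ((hq.mul hF.exp).inv (mul_ne_zero hD (Real.exp_ne_zero _))).congr_deriv ?_
  simp only [Pi.mul_apply]
  have := Real.exp_ne_zero (F t)
  field_simp
  ring

/-- In the case `4(e − g) − 1 < 0`, `e ≠ g`, `H16` is a first integral of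
system (11) wherever `A > 0`. -/
theorem stmt_16 (e g : ℝ) (hk : 4*(e - g) - 1 < 0) (heg : e ≠ g) :
    ∀ x y : ℝ, A16 e g (x, y) > 0 →
      fderiv ℝ (H16 e g) (x, y) (1, 0) *
          (y + x^2 * y * (1 + v11 e g (x, y))) +
        fderiv ℝ (H16 e g) (x, y) (0, 1) *
          (-x + x * y^2 * (1 + v11 e g (x, y))) = 0 := by
  intro x y hA
  set k := Real.sqrt (1 - 4 * (e - g)) with hk_def
  have hk0 : k ≠ 0 := (Real.sqrt_pos.mpr (by linarith)).ne'
  have hk2 : k ^ 2 = 1 - 4 * (e - g) := Real.sq_sqrt (by linarith)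
  have hA0 : ((1 + 2 * v11 e g (x, y) - k) * (1 + k)) /
      ((1 + 2 * v11 e g (x, y) + k) * (1 - k)) ≠ 0 := hA.ne'
  have hD : e - g + v11 e g (x, y) + v11 e g (x, y) ^ 2 ≠ 0 := by
    obtain ⟨hn, hd⟩ := div_ne_zero_iff.mp hA0
    have h := mul_ne_zero (left_ne_zero_of_mul hn) (left_ne_zero_of_mul hd)
    contrapose! h
    linear_combination 4 * h - hk2
  have hv : HasFDerivAt (v11 e g) _ (x, y) := hasFDerivAt_diagonal_form e g x y
  have hr := (hasFDerivAt_diagonal_form 1 1 x y).pow 2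
  have hφ := (hasDerivAt_inv_mul_exp hD
    (hasDerivAt_log_antiderivative hk0 hk2 hA0)).comp_hasFDerivAt (x, y) hv
  have hH := hr.mul hφ
  have hH' := hH.congr_of_eventuallyEq (f₁ := H16 e g) (Filter.Eventually.of_forall fun p => by
    simp [H16, A16, div_eq_mul_inv, hk_def])
  rw [hH'.fderiv]
  simp only [Function.comp_apply]
  have hE := Real.exp_ne_zero (1 / k * Real.log (((1 + 2 * v11 e g (x, y) - k) * (1 + k)) /
      ((1 + 2 * v11 e g (x, y) + k) * (1 - k))))
  generalize Real.exp (1 / k * Real.log (((1 + 2 * v11 e g (x, y) - k) * (1 + k)) /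
      ((1 + 2 * v11 e g (x, y) + k) * (1 - k)))) = E at hE ⊢
  simp
  field_simp
  simp only [v11]
  ring
end

section
/- Let e be a nonzero real number and consider system (11) with g = e, i.e., the vector field F(x,y) = (y + x²y(1 + e(x² + y²)), −x + x y²(1 + e(x² + y²))). Then the function H(x,y) = (x² + y²)/(1 + e(x² + y²)) · exp( (1/e)·(1 + x²)/(x² + y²) ) is a first integral of this system: at every point (x,y) with x² + y² ≠ 0 and 1 + e(x² + y²) ≠ 0, ∂H/∂x·(y + x²y(1 + e(x² + y²))) + ∂H/∂y·(−x + x y²(1 + e(x² + y²))) = 0. -/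
/-- The Darboux first integral of system (11) in the case `g = e ≠ 0`. -/
noncomputable def H17 (e : ℝ) (p : ℝ × ℝ) : ℝ :=
  (p.1^2 + p.2^2) / (1 + e * (p.1^2 + p.2^2)) *
    Real.exp ((1 / e) * (1 + p.1^2) / (p.1^2 + p.2^2))

theorem differentiableAt_H17 (e x y : ℝ) (hr : x^2 + y^2 ≠ 0)
    (hu : 1 + e * (x^2 + y^2) ≠ 0) : DifferentiableAt ℝ (H17 e) (x, y) := by
  unfold H17
  fun_prop (disch := assumption)

theorem hasDerivAt_H17_fst (e x y : ℝ) (hr : x^2 + y^2 ≠ 0)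
    (hu : 1 + e * (x^2 + y^2) ≠ 0) :
    HasDerivAt (fun t => H17 e (t, y))
      ((2 * x / (1 + e * (x^2 + y^2))^2 +
        (x^2 + y^2) / (1 + e * (x^2 + y^2)) *
          ((1 / e) * (2 * x * (x^2 + y^2) - (1 + x^2) * (2 * x)) / (x^2 + y^2)^2)) *
        Real.exp ((1 / e) * (1 + x^2) / (x^2 + y^2))) x := by
  have hs : HasDerivAt (fun t : ℝ => t^2) (2 * x) x := by simpa using hasDerivAt_pow 2 x
  have hrd := hs.add_const (y^2)
  have hud := (hrd.const_mul e).const_add 1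
  have hE := (((hs.const_add 1).const_mul (1 / e)).div hrd hr).exp
  refine ((hrd.div hud hu).mul hE).congr_deriv ?_
  simp only [Pi.div_apply]
  ring

theorem hasDerivAt_H17_snd (e x y : ℝ) (hr : x^2 + y^2 ≠ 0)
    (hu : 1 + e * (x^2 + y^2) ≠ 0) :
    HasDerivAt (fun t => H17 e (x, t))
      ((2 * y / (1 + e * (x^2 + y^2))^2 -
        (x^2 + y^2) / (1 + e * (x^2 + y^2)) *
          ((1 / e) * (1 + x^2) * (2 * y) / (x^2 + y^2)^2)) *
        Real.exp ((1 / e) * (1 + x^2) / (x^2 + y^2))) y := by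
  have hs : HasDerivAt (fun t : ℝ => t^2) (2 * y) y := by simpa using hasDerivAt_pow 2 y
  have hrd := hs.const_add (x^2)
  have hud := (hrd.const_mul e).const_add 1
  have hE := ((hasDerivAt_const y ((1 / e) * (1 + x^2))).div hrd hr).exp
  refine ((hrd.div hud hu).mul hE).congr_deriv ?_
  simp only [Pi.div_apply]
  ring

/-- For `e ≠ 0`, `H17` is a first integral of system (11) with `g = e`
wherever `x² + y² ≠ 0` and `1 + e(x² + y²) ≠ 0`. -/
theorem stmt_17 (e : ℝ) (he : e ≠ 0) :
    ∀ x y : ℝ, x^2 + y^2 ≠ 0 → 1 + e * (x^2 + y^2) ≠ 0 →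
      fderiv ℝ (H17 e) (x, y) (1, 0) *
          (y + x^2 * y * (1 + e * (x^2 + y^2))) +
        fderiv ℝ (H17 e) (x, y) (0, 1) *
          (-x + x * y^2 * (1 + e * (x^2 + y^2))) = 0 := by
  intro x y hr hu
  have hd := (differentiableAt_H17 e x y hr hu).hasFDerivAt
  have h1 := (HasFDerivAt.comp_hasDerivAt (l := H17 e) (f := fun t : ℝ => (t, y)) x hd
    ((hasDerivAt_id x).prodMk (hasDerivAt_const x y))).unique (hasDerivAt_H17_fst e x y hr hu)
  have h2 := (HasFDerivAt.comp_hasDerivAt (l := H17 e) (f := fun t : ℝ => (x, t)) y hd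
    ((hasDerivAt_const y x).prodMk (hasDerivAt_id y))).unique (hasDerivAt_H17_snd e x y hr hu)
  rw [h1, h2]
  field_simp
  ring
end

section
/- Let a, b be real numbers and define the vector fields X(x,y) = (y + x(a x² + b x y − a y²), −x + y(a x² + b x y − a y²)) and Y(x,y) = (x + x(b x² − 2a x y), y + y(b x² − 2a x y)). Then X and Y commute: DX(x,y)·Y(x,y) − DY(x,y)·X(x,y) = 0 for all (x,y) ∈ ℝ². -/
/-- The quasi-homogeneous O-symmetric cubic system
`ẋ = y + x(ax² + bxy − ay²), ẏ = −x + y(ax² + bxy − ay²)`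
commutes with `ẋ = x + x(bx² − 2axy), ẏ = y + y(bx² − 2axy)`. -/
theorem stmt_18 (a b : ℝ) :
    ∀ p : ℝ × ℝ,
      fderiv ℝ (fun q : ℝ × ℝ =>
          (q.2 + q.1 * (a * q.1^2 + b * q.1 * q.2 - a * q.2^2),
           -q.1 + q.2 * (a * q.1^2 + b * q.1 * q.2 - a * q.2^2))) p
          ((fun q : ℝ × ℝ =>
            (q.1 + q.1 * (b * q.1^2 - 2*a * q.1 * q.2),
             q.2 + q.2 * (b * q.1^2 - 2*a * q.1 * q.2))) p) -
        fderiv ℝ (fun q : ℝ × ℝ =>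
          (q.1 + q.1 * (b * q.1^2 - 2*a * q.1 * q.2),
           q.2 + q.2 * (b * q.1^2 - 2*a * q.1 * q.2))) p
          ((fun q : ℝ × ℝ =>
            (q.2 + q.1 * (a * q.1^2 + b * q.1 * q.2 - a * q.2^2),
             -q.1 + q.2 * (a * q.1^2 + b * q.1 * q.2 - a * q.2^2))) p)
      = 0 := by
  intro p
  have h1 : HasFDerivAt (fun q : ℝ × ℝ => q.1) (ContinuousLinearMap.fst ℝ ℝ ℝ) p :=
    hasFDerivAt_fst
  have h2 : HasFDerivAt (fun q : ℝ × ℝ => q.2) (ContinuousLinearMap.snd ℝ ℝ ℝ) p :=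
    hasFDerivAt_snd
  have hf := (((h1.pow 2).const_mul a).add ((h1.const_mul b).mul h2)).sub ((h2.pow 2).const_mul a)
  have hg := ((h1.pow 2).const_mul b).sub ((h1.const_mul (2 * a)).mul h2)
  have hX := (h2.add (h1.mul hf)).prodMk (h1.neg.add (h2.mul hf))
  have hY := (h1.add (h1.mul hg)).prodMk (h2.add (h2.mul hg))
  erw [hX.fderiv, hY.fderiv]
  ext <;> simp <;> ring
end

section
/- Let a, b be real numbers. Then H(x,y) = (x² + y²)/(1 + b x² − 2a x y) is a first integral of the cubic system ẋ = y + x(a x² + b x y − a y²), ẏ = −x + y(a x² + b x y − a y²): at every point (x,y) with 1 + b x² − 2a x y ≠ 0, ∂H/∂x·(y + x(a x² + b x y − a y²)) + ∂H/∂y·(−x + y(a x² + b x y − a y²)) = 0. -/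
/-- The rational first integral of the cubic system. -/
noncomputable def H19 (a b : ℝ) (p : ℝ × ℝ) : ℝ :=
  (p.1^2 + p.2^2) / (1 + b * p.1^2 - 2*a * p.1 * p.2)

/-- `H = (x² + y²)/(1 + bx² − 2axy)` is a first integral of the cubic system
`ẋ = y + x(ax² + bxy − ay²), ẏ = −x + y(ax² + bxy − ay²)`
wherever `1 + bx² − 2axy ≠ 0`. -/
theorem stmt_19 (a b : ℝ) :
    ∀ x y : ℝ, 1 + b * x^2 - 2*a * x * y ≠ 0 →
      fderiv ℝ (H19 a b) (x, y) (1, 0) *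
          (y + x * (a * x^2 + b * x * y - a * y^2)) +
        fderiv ℝ (H19 a b) (x, y) (0, 1) *
          (-x + y * (a * x^2 + b * x * y - a * y^2)) = 0 := by
  intro x y hD
  have hx : HasFDerivAt (fun p : ℝ × ℝ => p.1) (ContinuousLinearMap.fst ℝ ℝ ℝ) (x, y) :=
    hasFDerivAt_fst
  have hy : HasFDerivAt (fun p : ℝ × ℝ => p.2) (ContinuousLinearMap.snd ℝ ℝ ℝ) (x, y) :=
    hasFDerivAt_snd
  have hden : HasFDerivAt (fun p : ℝ × ℝ => 1 + b * p.1 ^ 2 - 2 * a * p.1 * p.2) _ (x, y) :=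
    (((hx.pow 2).const_mul b).const_add 1).fun_sub ((hx.const_mul (2 * a)).fun_mul hy)
  have hH : HasFDerivAt (H19 a b) _ (x, y) :=
    ((hx.pow 2).fun_add (hy.pow 2)).fun_mul ((hasDerivAt_inv hD).comp_hasFDerivAt (x, y) hden)
  rw [hH.fderiv]
  simp
  field_simp
  ring
end
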